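/- arXiv:1605.05555 — 5 statements merged into one kernel-verified Lean document; each statement's English description precedes it below -/
import Mathlib

section
/- Let (Ω, F, P) be a probability space, (X_n) a sequence of real-valued random variables, and 0 < α ≤ 1, 0 < β ≤ 1. If X_n →^{PS^α} X and X_n →^{PS^β} Y, then P(X = Y) = 1. -/
open MeasureTheory Filter Finset

/-- `P(|X - Y| ≥ ε)` as a real number. -/
noncomputable def probGe {Ω : Type*} [MeasurableSpace Ω] (μ : Measure Ω)
    (X Y : Ω → ℝ) (ε : ℝ) : ℝ :=
  (μ {ω | ε ≤ |X ω - Y ω|}).toReal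

open scoped Classical in
/-- Statistical convergence of order `α` in probability of a sequence of random
variables `X` to a random variable `L`:
for every `ε > 0` and `δ > 0`, `(1/n^α)·|{k ≤ n : P(|X_k − L| ≥ ε) ≥ δ}| → 0`. -/
noncomputable def StatConvProb {Ω : Type*} [MeasurableSpace Ω] (μ : Measure Ω)
    (α : ℝ) (X : ℕ → Ω → ℝ) (L : Ω → ℝ) : Prop :=
  ∀ ε > (0 : ℝ), ∀ δ > (0 : ℝ),
    Tendsto (fun n : ℕ =>
        (((Finset.Icc 1 n).filter fun k => δ ≤ probGe μ (X k) L ε).card : ℝ) / (n : ℝ) ^ α)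
      atTop (nhds 0)

/-- Statistical convergence in probability of order `α` implies that of any order `γ ≥ α`. -/
theorem StatConvProb.mono_order {Ω : Type*} [MeasurableSpace Ω] {μ : Measure Ω} {α γ : ℝ}
    {X : ℕ → Ω → ℝ} {L : Ω → ℝ} (h : StatConvProb μ α X L) (hαγ : α ≤ γ) :
    StatConvProb μ γ X L := by
  intro ε hε δ hδ
  refine squeeze_zero' (Eventually.of_forall fun n => by positivity) ?_ (h ε hε δ hδ)
  filter_upwards [eventually_ge_atTop 1] with n hn
  have hn' : (1 : ℝ) ≤ n := by exact_mod_cast hn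
  have hpos : (0 : ℝ) < (n : ℝ) ^ α := Real.rpow_pos_of_pos (by linarith) α
  have hle := Real.rpow_le_rpow_of_exponent_le hn' hαγ
  gcongr

theorem probGe_triangle {Ω : Type*} [MeasurableSpace Ω] (μ : Measure Ω) [IsFiniteMeasure μ]
    (W Y Z : Ω → ℝ) (ε : ℝ) :
    probGe μ Y Z ε ≤ probGe μ W Y (ε / 2) + probGe μ W Z (ε / 2) := by
  refine (measureReal_mono (μ := μ) (fun ω hω => ?_)).trans (measureReal_union_le _ _)
  simp only [Set.mem_union, Set.mem_ofPred_eq] at hω ⊢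
  by_contra! h
  have := abs_sub_le (Y ω) (W ω) (Z ω)
  rw [abs_sub_comm (Y ω) (W ω)] at this
  linarith [h.1, h.2]

/-- Two statistical limits of order one are simultaneously approximated by some term of the
sequence. -/
theorem StatConvProb.exists_probGe_lt {Ω : Type*} [MeasurableSpace Ω] {μ : Measure Ω}
    {X : ℕ → Ω → ℝ} {Y Z : Ω → ℝ} (hY : StatConvProb μ 1 X Y) (hZ : StatConvProb μ 1 X Z)
    {ε δ : ℝ} (hε : 0 < ε) (hδ : 0 < δ) :
    ∃ k, probGe μ (X k) Y ε < δ ∧ probGe μ (X k) Z ε < δ := by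
  classical
  by_contra! h
  have hsum := (hY ε hε δ hδ).add (hZ ε hε δ hδ)
  rw [add_zero] at hsum
  obtain ⟨n, hlt, hn⟩ :=
    ((hsum.eventually_lt_const one_pos).and (eventually_ge_atTop 1)).exists
  have hn' : (0 : ℝ) < n := by exact_mod_cast hn
  rw [Real.rpow_one, ← add_div, div_lt_one hn'] at hlt
  norm_cast at hlt
  have hsub : Finset.Icc 1 n ⊆ ((Finset.Icc 1 n).filter fun k => δ ≤ probGe μ (X k) Y ε) ∪
      (Finset.Icc 1 n).filter fun k => δ ≤ probGe μ (X k) Z ε := by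
    intro k hk
    simp only [Finset.mem_union, Finset.mem_filter, hk, true_and]
    exact (lt_or_ge (probGe μ (X k) Y ε) δ).symm.imp_right (h k)
  have hcard := (Finset.card_le_card hsub).trans (Finset.card_union_le _ _)
  rw [Nat.card_Icc, Nat.add_sub_cancel] at hcard
  refine hlt.not_ge (hcard.trans (le_of_eq ?_))
  congr!

/-- Random variables that differ by at least `ε` with probability zero, for each `ε > 0`, agree
almost everywhere. -/
theorem ae_eq_of_forall_probGe_eq_zero {Ω : Type*} [MeasurableSpace Ω] {μ : Measure Ω}
    [IsFiniteMeasure μ] {Y Z : Ω → ℝ} (h : ∀ ε > 0, probGe μ Y Z ε = 0) : Y =ᵐ[μ] Z := by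
  have hlt : ∀ n : ℕ, ∀ᵐ ω ∂μ, |Y ω - Z ω| < 1 / ((n : ℝ) + 1) := fun n => by
    have h0 := (measureReal_eq_zero_iff (μ := μ)).1 (h (1 / ((n : ℝ) + 1)) (by positivity))
    simpa only [ae_iff, not_lt] using h0
  filter_upwards [ae_all_iff.2 hlt] with ω hω
  by_contra hne
  obtain ⟨n, hn⟩ := exists_nat_one_div_lt (abs_pos.2 (sub_ne_zero.2 hne))
  exact (hω n).not_gt hn

/-- Uniqueness of the `PS^α` limit: if `X_n →^{PS^α} X` and `X_n →^{PS^β} Y`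
then `P(X = Y) = 1`. -/
theorem statConvProb_limit_unique
    {Ω : Type*} [MeasurableSpace Ω] (μ : Measure Ω) [IsProbabilityMeasure μ]
    (α β : ℝ) (hα0 : 0 < α) (hα1 : α ≤ 1) (hβ0 : 0 < β) (hβ1 : β ≤ 1)
    (X : ℕ → Ω → ℝ) (Y Z : Ω → ℝ)
    (hXmeas : ∀ n, Measurable (X n)) (hYmeas : Measurable Y) (hZmeas : Measurable Z)
    (hY : StatConvProb μ α X Y) (hZ : StatConvProb μ β X Z) :
    μ {ω | Y ω = Z ω} = 1 := by
  have hae : Y =ᵐ[μ] Z := ae_eq_of_forall_probGe_eq_zero fun ε hε => by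
    refine le_antisymm (le_of_forall_pos_le_add fun δ hδ => ?_) ENNReal.toReal_nonneg
    obtain ⟨k, hkY, hkZ⟩ := (hY.mono_order hα1).exists_probGe_lt (hZ.mono_order hβ1)
      (half_pos hε) (half_pos hδ)
    linarith [probGe_triangle μ (X k) Y Z ε]
  exact (prob_compl_eq_zero_iff (measurableSet_eq_fun hYmeas hZmeas)).1 hae
end

section
/- For any real numbers 0 < α < β ≤ 1, there exist a probability space (Ω, F, P), a sequence (X_n) of real-valued random variables on it, and a random variable X, such that X_n →^{PS^β} X but (X_n) is not statistically convergent of order α in probability to X. -/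
open MeasureTheory Filter Finset

/-- The set of jumps of an integer sequence that starts at `0` and grows by steps of size
at most one has exactly `f n` elements in `[1, n]`. -/
lemma card_filter_lt_eq_of_le_succ {f : ℕ → ℕ} (h0 : f 0 = 0) (hmono : Monotone f)
    (hstep : ∀ n, f (n + 1) ≤ f n + 1) (n : ℕ) :
    ((Finset.Icc 1 n).filter fun k => f (k - 1) < f k).card = f n := by
  induction n with
  | zero => simp [h0]
  | succ n ih =>
    have h1 : f n ≤ f (n + 1) := hmono n.le_succ
    have h2 := hstep n
    rw [← Finset.insert_Icc_right_eq_Icc_add_one (by omega), Finset.filter_insert]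
    split_ifs with h
    · rw [Finset.card_insert_of_notMem (by simp), ih]
      simp only [Nat.add_sub_cancel] at h
      omega
    · rw [ih]
      simp only [Nat.add_sub_cancel] at h
      omega

lemma card_filter_floor_rpow_lt {α : ℝ} (hα0 : 0 < α) (hα1 : α ≤ 1) (n : ℕ) :
    ((Finset.Icc 1 n).filter fun k : ℕ =>
      ⌊((k - 1 : ℕ) : ℝ) ^ α⌋₊ < ⌊(k : ℝ) ^ α⌋₊).card = ⌊(n : ℝ) ^ α⌋₊ := by
  refine card_filter_lt_eq_of_le_succ (f := fun n : ℕ => ⌊(n : ℝ) ^ α⌋₊) ?_ ?_ ?_ n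
  · simp [Real.zero_rpow hα0.ne']
  · intro m n hmn
    dsimp only
    gcongr
  · intro n
    have h : ((n + 1 : ℕ) : ℝ) ^ α ≤ (n : ℝ) ^ α + 1 := by
      simpa using Real.rpow_add_le_add_rpow n.cast_nonneg zero_le_one hα0.le hα1
    rw [← Nat.floor_add_one (by positivity)]
    exact Nat.floor_le_floor h

lemma probGe_const {Ω : Type*} [MeasurableSpace Ω] (μ : Measure Ω) [IsProbabilityMeasure μ]
    (a b ε : ℝ) [Decidable (ε ≤ |a - b|)] :
    probGe μ (fun _ => a) (fun _ => b) ε = if ε ≤ |a - b| then 1 else 0 := by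
  unfold probGe
  split_ifs with h <;> simp [h]

/-- For any `0 < α < β ≤ 1` the inclusion `PS^α ⊂ PS^β` is strict: there is a
sequence of random variables which is statistically convergent of order `β` in
probability but not of order `α`. -/
theorem exists_statConvProb_order_beta_not_alpha
    (α β : ℝ) (hα0 : 0 < α) (hαβ : α < β) (hβ1 : β ≤ 1) :
    ∃ (Ω : Type) (_ : MeasurableSpace Ω) (μ : Measure Ω),
      IsProbabilityMeasure μ ∧
      ∃ (X : ℕ → Ω → ℝ) (L : Ω → ℝ),
        (∀ n, Measurable (X n)) ∧ Measurable L ∧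
        StatConvProb μ β X L ∧ ¬ StatConvProb μ α X L := by
  classical
  have hfloor := card_filter_floor_rpow_lt hα0 (hαβ.le.trans hβ1)
  refine ⟨Unit, inferInstance, Measure.dirac (), inferInstance,
    fun k _ => if ⌊((k - 1 : ℕ) : ℝ) ^ α⌋₊ < ⌊(k : ℝ) ^ α⌋₊ then 1 else 0, fun _ => 0,
    fun _ => measurable_const, measurable_const, ?_, ?_⟩
  · intro ε hε δ hδ
    have hlim : Tendsto (fun n : ℕ => (n : ℝ) ^ (-(β - α))) atTop (nhds 0) :=
      (tendsto_rpow_neg_atTop (sub_pos.2 hαβ)).comp tendsto_natCast_atTop_atTop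
    refine squeeze_zero' (Eventually.of_forall fun n => by positivity) ?_ hlim
    filter_upwards [eventually_gt_atTop 0] with n hn
    have hn' : (0 : ℝ) < n := by exact_mod_cast hn
    rw [neg_sub, Real.rpow_sub hn']
    gcongr
    refine le_trans ?_ (Nat.floor_le (by positivity : 0 ≤ (n : ℝ) ^ α))
    rw [← hfloor n]
    refine Nat.cast_le.2 (Finset.card_le_card
      (Finset.monotone_filter_right _ fun k _ hk => ?_))
    by_contra hlt
    rw [probGe_const, if_neg hlt, if_neg (by simpa using hε)] at hk
    exact hδ.not_ge hk
  · intro h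
    have hone : Tendsto (fun n : ℕ => (⌊(n : ℝ) ^ α⌋₊ : ℝ) / (n : ℝ) ^ α) atTop (nhds 1) :=
      tendsto_nat_floor_div_atTop.comp
        ((tendsto_rpow_atTop hα0).comp tendsto_natCast_atTop_atTop)
    refine zero_ne_one (tendsto_nhds_unique ((h 1 one_pos 1 one_pos).congr fun n => ?_) hone)
    rw [← hfloor n]
    congr 3
    refine Finset.filter_congr fun k _ => ?_
    rw [probGe_const]
    by_cases hk : ⌊((k - 1 : ℕ) : ℝ) ^ α⌋₊ < ⌊(k : ℝ) ^ α⌋₊ <;> simp only [hk] <;> norm_num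
end

section
/- There exist two lacunary sequences θ₁ and θ₂, a probability space (Ω, F, P), and a single sequence (X_n) of real-valued random variables on it, such that X_n →^{PS_{θ₁}^1} 0 and X_n →^{PS_{θ₂}^1} 1; that is, the lacunary statistical limit in probability of a sequence of random variables may differ for different lacunary sequences. -/
open MeasureTheory Filter Finset

/-- A lacunary sequence: a strictly increasing sequence `k` of naturals with
`k 0 = 0` and `h_r = k r − k (r-1) → ∞`.  (Here we index the `r`-th gap as
`k (r+1) - k r`.) -/
structure LacunarySeq where
  k : ℕ → ℕ
  k_zero : k 0 = 0
  k_mono : StrictMono k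
  h_tendsto : Tendsto (fun r : ℕ => k (r + 1) - k r) atTop atTop

open scoped Classical in
/-- Lacunary statistical (`S_θ`-) convergence of order `α` in probability:
for every `ε > 0`, `δ > 0`, `(1/h_r^α)·|{k ∈ I_r : P(|X_k − L| ≥ ε) ≥ δ}| → 0`,
where `I_r = (k_{r-1}, k_r]`. -/
noncomputable def LacStatConvProb (θ : LacunarySeq) {Ω : Type*} [MeasurableSpace Ω]
    (μ : Measure Ω) (α : ℝ) (X : ℕ → Ω → ℝ) (L : Ω → ℝ) : Prop :=
  ∀ ε > (0 : ℝ), ∀ δ > (0 : ℝ),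
    Tendsto (fun r : ℕ =>
        (((Finset.Ioc (θ.k r) (θ.k (r + 1))).filter fun k => δ ≤ probGe μ (X k) L ε).card : ℝ)
          / ((θ.k (r + 1) - θ.k r : ℕ) : ℝ) ^ α)
      atTop (nhds 0)

/-- If `X` agrees with `L` on the `r`-th block past an initial part of relative length at most
`1 / (r + 1)`, then `X` converges lacunary statistically in probability to `L`. -/
theorem LacStatConvProb.of_eq_on_tails {θ : LacunarySeq} {Ω : Type*} [MeasurableSpace Ω]
    {μ : Measure Ω} {X : ℕ → Ω → ℝ} {L : Ω → ℝ}
    (h : ∀ r, ∃ m, (∀ k ∈ Ioc m (θ.k (r + 1)), X k = L) ∧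
      (r + 1) * (m - θ.k r) ≤ θ.k (r + 1) - θ.k r) :
    LacStatConvProb θ μ 1 X L := by
  classical
  intro ε hε δ hδ
  refine squeeze_zero (fun r => by positivity) (fun r => ?_)
    (tendsto_one_div_add_atTop_nhds_zero_nat (𝕜 := ℝ))
  obtain ⟨m, hm, hle⟩ := h r
  have hpos : 0 < θ.k (r + 1) - θ.k r := Nat.sub_pos_of_lt (θ.k_mono r.lt_succ_self)
  have hcard : ((Ioc (θ.k r) (θ.k (r + 1))).filter
      fun k => δ ≤ probGe μ (X k) L ε).card ≤ m - θ.k r := by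
    rw [← Nat.card_Ioc]
    refine card_le_card fun k hk => ?_
    obtain ⟨hk, hbad⟩ := mem_filter.1 hk
    rw [mem_Ioc] at hk ⊢
    refine ⟨hk.1, not_lt.1 fun hlt => ?_⟩
    rw [hm k (mem_Ioc.2 ⟨hlt, hk.2⟩)] at hbad
    simp only [probGe, sub_self, abs_zero, not_le.2 hε, Set.ofPred_false, measure_empty,
      ENNReal.toReal_zero] at hbad
    exact hδ.not_ge hbad
  rw [Real.rpow_one, div_le_div_iff₀ (by exact_mod_cast hpos) (by positivity), one_mul]
  have := (Nat.mul_le_mul_left (r + 1) hcard).trans hle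
  rw [mul_comm] at this
  exact_mod_cast this

/-- The rapidly growing sequence `0, 1, 5, 23, …`. -/
def factorialPred (n : ℕ) : ℕ := (n + 1).factorial - 1

theorem factorialPred_strictMono : StrictMono factorialPred := by
  refine strictMono_nat_of_lt_succ fun n => ?_
  have h := Nat.factorial_lt_of_lt (Nat.succ_pos n) (Nat.lt_succ_self (n + 1))
  have := Nat.factorial_pos (n + 1)
  unfold factorialPred
  simp only [Nat.succ_eq_add_one] at h
  omega

theorem succ_mul_factorialPred_sub_le (n : ℕ) :
    (n + 1) * (factorialPred (n + 1) - factorialPred n) ≤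
      factorialPred (n + 2) - factorialPred n := by
  have hf := Nat.factorial_pos (n + 1)
  have h1 : factorialPred (n + 1) - factorialPred n = (n + 1) * (n + 1).factorial := by
    have : (n + 2).factorial = (n + 1) * (n + 1).factorial + (n + 1).factorial := by
      rw [Nat.factorial_succ (n + 1)]; ring
    change (n + 2).factorial - 1 - ((n + 1).factorial - 1) = _
    omega
  have h2 : factorialPred (n + 2) - factorialPred n
      = (n ^ 2 + 5 * n + 5) * (n + 1).factorial := by
    have : (n + 3).factorial
        = (n ^ 2 + 5 * n + 5) * (n + 1).factorial + (n + 1).factorial := by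
      rw [Nat.factorial_succ (n + 2), Nat.factorial_succ (n + 1)]; ring
    change (n + 3).factorial - 1 - ((n + 1).factorial - 1) = _
    omega
  rw [h1, h2, ← mul_assoc]
  exact Nat.mul_le_mul_right _ (by nlinarith)

theorem succ_le_factorialPred_sub (n : ℕ) :
    n + 1 ≤ factorialPred (n + 2) - factorialPred n :=
  (Nat.le_mul_of_pos_right _
    (Nat.sub_pos_of_lt (factorialPred_strictMono n.lt_succ_self))).trans
    (succ_mul_factorialPred_sub_le n)

/-- The lacunary sequence of even-indexed terms of `factorialPred`. -/
def evenLacunarySeq : LacunarySeq where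
  k r := factorialPred (2 * r)
  k_zero := rfl
  k_mono := factorialPred_strictMono.comp fun _ _ h => by omega
  h_tendsto := tendsto_atTop_mono
    (fun r => le_trans (by simp only [id]; omega) (succ_le_factorialPred_sub (2 * r))) tendsto_id

/-- The lacunary sequence consisting of `0` and the odd-indexed terms of `factorialPred`. -/
def oddLacunarySeq : LacunarySeq where
  k r := factorialPred (2 * r - 1)
  k_zero := rfl
  k_mono := factorialPred_strictMono.comp fun _ _ h => by omega
  h_tendsto := by
    refine tendsto_atTop_mono (fun r => ?_) tendsto_id
    obtain _ | r := r
    · exact Nat.zero_le _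
    · exact le_trans (by simp only [id]; omega) (succ_le_factorialPred_sub (2 * r + 1))

/-- The union of the blocks `(factorialPred (2 n), factorialPred (2 n + 1)]`. -/
def evenBlocks : Set ℕ :=
  {k | ∃ n, factorialPred (2 * n) < k ∧ k ≤ factorialPred (2 * n + 1)}

theorem notMem_evenBlocks {r k : ℕ} (h₁ : factorialPred (2 * r + 1) < k)
    (h₂ : k ≤ factorialPred (2 * r + 2)) : k ∉ evenBlocks := by
  rintro ⟨n, hn₁, hn₂⟩
  have h₃ := factorialPred_strictMono.lt_iff_lt.1 (hn₁.trans_le h₂)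
  have h₄ := factorialPred_strictMono.lt_iff_lt.1 (h₁.trans_le hn₂)
  omega

/-- The `PS_θ` limit of a sequence of random variables may differ for two
different lacunary sequences: there are lacunary sequences `θ₁, θ₂` and a single
sequence of random variables converging `PS_{θ₁}`-statistically in probability
to `0` and `PS_{θ₂}`-statistically in probability to `1`. -/
theorem exists_lacStatConvProb_different_limits :
    ∃ (θ₁ θ₂ : LacunarySeq) (Ω : Type) (_ : MeasurableSpace Ω) (μ : Measure Ω),
      IsProbabilityMeasure μ ∧
      ∃ X : ℕ → Ω → ℝ,
        (∀ n, Measurable (X n)) ∧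
        LacStatConvProb θ₁ μ 1 X (fun _ => (0 : ℝ)) ∧
        LacStatConvProb θ₂ μ 1 X (fun _ => (1 : ℝ)) := by
  refine ⟨evenLacunarySeq, oddLacunarySeq, Unit, inferInstance, Measure.dirac (), inferInstance,
    fun k _ => evenBlocks.indicator 1 k, fun _ => measurable_const, ?_, ?_⟩
  · refine LacStatConvProb.of_eq_on_tails fun r => ⟨factorialPred (2 * r + 1), ?_, ?_⟩
    · intro k hk
      obtain ⟨h₁, h₂⟩ := mem_Ioc.1 hk
      exact funext fun _ => Set.indicator_of_notMem (notMem_evenBlocks h₁ h₂) _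
    · exact le_trans (Nat.mul_le_mul_right _ (by omega))
        (succ_mul_factorialPred_sub_le (2 * r))
  · refine LacStatConvProb.of_eq_on_tails fun r => ⟨factorialPred (2 * r), ?_, ?_⟩
    · intro k hk
      exact funext fun _ => Set.indicator_of_mem (s := evenBlocks) ⟨r, mem_Ioc.1 hk⟩ 1
    · obtain _ | r := r
      · exact Nat.zero_le _
      · exact le_trans (Nat.mul_le_mul_right _ (by omega))
          (succ_mul_factorialPred_sub_le (2 * r + 1))
end

section
/- Let θ = (k_r) be a lacunary sequence with liminf_{r→∞} q_r > 1, where q_r = k_r/k_{r−1}, let (Ω, F, P) be a probability space, (X_n) a sequence of real-valued random variables, and 0 < α ≤ β ≤ 1. If X_n →^{PS^α} X, then X_n →^{PS_θ^β} X. -/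
open MeasureTheory Filter Finset

/-- If `liminf q_r > 1` (where `q_r = k_r / k_{r-1}`) and `0 < α ≤ β ≤ 1`, then
statistical convergence of order `α` in probability implies `S_θ`-convergence
of order `β` in probability. -/
theorem statConvProb_implies_lacStatConvProb_of_one_lt_liminf
    (θ : LacunarySeq)
    (hq : 1 < Filter.liminf (fun r : ℕ => (θ.k (r + 1) : ℝ) / (θ.k r : ℝ)) atTop)
    {Ω : Type*} [MeasurableSpace Ω] (μ : Measure Ω) [IsProbabilityMeasure μ]
    (α β : ℝ) (hα0 : 0 < α) (hαβ : α ≤ β) (hβ1 : β ≤ 1)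
    (X : ℕ → Ω → ℝ) (L : Ω → ℝ)
    (hXmeas : ∀ n, Measurable (X n)) (hLmeas : Measurable L)
    (hX : StatConvProb μ α X L) :
    LacStatConvProb θ μ β X L := by
  intro ε hε δ hδ
  obtain ⟨c, hc1, hc⟩ := exists_between hq
  have hc0 : 0 < c := by linarith
  have hs : 0 < 1 - c⁻¹ := sub_pos.2 (inv_lt_one_of_one_lt₀ hc1)
  have hratio := eventually_lt_of_lt_liminf hc
    (isBoundedUnder_of ⟨0, fun r => by positivity⟩)
  have hlim := (((hX ε hε δ hδ).comp
    (θ.k_mono.tendsto_atTop.comp (tendsto_add_atTop_nat 1))).const_mul (((1 - c⁻¹) ^ α)⁻¹))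
  rw [mul_zero] at hlim
  refine squeeze_zero' (Eventually.of_forall fun r => by positivity) ?_ hlim
  filter_upwards [hratio, eventually_ge_atTop 1] with r hr hr1
  have hk0 : 0 < θ.k r := by
    simpa [θ.k_zero] using θ.k_mono (Nat.lt_of_lt_of_le Nat.zero_lt_one hr1)
  have hlt : θ.k r < θ.k (r + 1) := θ.k_mono r.lt_succ_self
  have hk1 : (0 : ℝ) < θ.k (r + 1) := by exact_mod_cast hk0.trans hlt
  have hh1 : (1 : ℝ) ≤ ((θ.k (r + 1) - θ.k r : ℕ) : ℝ) := by
    exact_mod_cast Nat.sub_pos_of_lt hlt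
  have hgap : (1 - c⁻¹) * θ.k (r + 1) ≤ ((θ.k (r + 1) - θ.k r : ℕ) : ℝ) := by
    rw [Nat.cast_sub hlt.le, sub_mul, one_mul]
    rw [lt_div_iff₀ (by exact_mod_cast hk0)] at hr
    have : (θ.k r : ℝ) ≤ c⁻¹ * θ.k (r + 1) := by
      rw [inv_mul_eq_div, le_div_iff₀ hc0]
      linarith
    linarith
  have hpow : (1 - c⁻¹) ^ α * (θ.k (r + 1) : ℝ) ^ α ≤
      ((θ.k (r + 1) - θ.k r : ℕ) : ℝ) ^ β := by
    rw [← Real.mul_rpow hs.le hk1.le]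
    exact (Real.rpow_le_rpow (by positivity) hgap hα0.le).trans
      (Real.rpow_le_rpow_of_exponent_le hh1 hαβ)
  simp only [Function.comp_apply]
  rw [← div_eq_inv_mul, div_div, mul_comm (_ ^ α) ((1 - c⁻¹) ^ α)]
  refine div_le_div₀ (by positivity) ?_ (by positivity) hpow
  refine Nat.cast_le.2 (Finset.card_le_card (Finset.filter_subset_filter _ fun m hm => ?_))
  rw [Finset.mem_Ioc] at hm
  exact Finset.mem_Icc.2 ⟨by omega, hm.2⟩
end

section
/- Let θ = (k_r) be a lacunary sequence with liminf_{r→∞} q_r = 1, where q_r = k_r/k_{r−1}. Then there exist a probability space (Ω, F, P), a sequence (X_n) of real-valued random variables on it, and a random variable X, such that X_n →^{PS^1} X (statistical convergence in probability) but for every 0 < β ≤ 1 the sequence (X_n) is not S_θ-convergent of order β in probability to X. -/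
open MeasureTheory Filter Finset

/-- If the ratios of a lacunary sequence have lower limit `1`, then infinitely many of its blocks
are short compared with their left end point. -/
theorem LacunarySeq.exists_gap_le_of_liminf_eq_one (θ : LacunarySeq)
    (hq : Filter.liminf (fun r : ℕ => (θ.k (r + 1) : ℝ) / (θ.k r : ℝ)) atTop = 1)
    {η : ℝ} (hη : 0 < η) (N : ℕ) :
    ∃ r ≥ N, ((θ.k (r + 1) - θ.k r : ℕ) : ℝ) ≤ η * θ.k r := by
  by_contra! hcon
  have hmem : ∀ᶠ r : ℕ in atTop, 1 + η ≤ (θ.k (r + 1) : ℝ) / (θ.k r : ℝ) := by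
    filter_upwards [eventually_ge_atTop (N + 1)] with r hr
    have hpos : 0 < θ.k r := by
      have := θ.k_mono (show 0 < r by omega)
      omega
    have h := hcon r (by omega)
    rw [Nat.cast_sub (θ.k_mono.monotone r.le_succ)] at h
    rw [le_div_iff₀ (by exact_mod_cast hpos)]
    linarith
  rw [Filter.liminf_eq] at hq
  by_cases hb : BddAbove {a : ℝ | ∀ᶠ r : ℕ in atTop, a ≤ (θ.k (r + 1) : ℝ) / (θ.k r : ℝ)}
  · have := le_csSup hb hmem
    linarith
  · rw [Real.sSup_of_not_bddAbove hb] at hq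
    exact zero_ne_one hq

/-- A union of blocks `(a j, b j]` with `b j - a j ≤ a j / 2 ^ j` and `j ≤ a j` has natural
density zero. -/
theorem tendsto_card_filter_div_of_short_blocks {a b : ℕ → ℕ} (ha : ∀ j, j ≤ a j)
    (hab : ∀ j, ((b j - a j : ℕ) : ℝ) ≤ (1 / 2) ^ j * a j)
    (p : ℕ → Prop) [DecidablePred p] (hp : ∀ m, p m → ∃ j, m ∈ Ioc (a j) (b j)) :
    Tendsto (fun n : ℕ => (((Icc 1 n).filter p).card : ℝ) / n) atTop (nhds 0) := by
  let f : ℕ → ℕ → ℝ := fun n j => if a j < n then ((b j - a j : ℕ) : ℝ) / n else 0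
  have hf_nonneg : ∀ n j, 0 ≤ f n j := by
    intro n j
    dsimp only [f]
    split_ifs <;> positivity
  have hf_le : ∀ n j, f n j ≤ (1 / 2) ^ j := by
    intro n j
    dsimp only [f]
    split_ifs with h
    · have hn : (0 : ℝ) < n := by exact_mod_cast (Nat.zero_le _).trans_lt h
      rw [div_le_iff₀ hn]
      refine (hab j).trans ?_
      gcongr
    · positivity
  have hlim : Tendsto (fun n => ∑' j, f n j) atTop (nhds 0) := by
    rw [← tsum_zero (α := ℝ) (β := ℕ)]
    refine tendsto_tsum_of_dominated_convergence summable_geometric_two (fun j => ?_)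
      (Eventually.of_forall fun n j => ?_)
    · refine (tendsto_const_div_atTop_nhds_zero_nat ((b j - a j : ℕ) : ℝ)).congr' ?_
      filter_upwards [eventually_gt_atTop (a j)] with n hn
      simp only [f, if_pos hn]
    · rw [Real.norm_of_nonneg (hf_nonneg n j)]
      exact hf_le n j
  refine squeeze_zero (fun n => by positivity) (fun n => ?_) hlim
  have hsub : (Icc 1 n).filter p ⊆
      ((range n).filter fun j => a j < n).biUnion fun j => Ioc (a j) (b j) := by
    intro m hm
    simp only [Finset.mem_filter, Finset.mem_Icc] at hm
    obtain ⟨j, hj⟩ := hp m hm.2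
    have hj' := Finset.mem_Ioc.1 hj
    have := ha j
    exact Finset.mem_biUnion.2 ⟨j, by simp only [Finset.mem_filter, Finset.mem_range]; omega, hj⟩
  have hcard : (((Icc 1 n).filter p).card : ℝ) ≤
      ∑ j ∈ (range n).filter fun j => a j < n, ((b j - a j : ℕ) : ℝ) := by
    have h := (Finset.card_le_card hsub).trans Finset.card_biUnion_le
    simp only [Nat.card_Ioc] at h
    exact_mod_cast h
  calc (((Icc 1 n).filter p).card : ℝ) / n
      ≤ (∑ j ∈ (range n).filter fun j => a j < n, ((b j - a j : ℕ) : ℝ)) / n := by gcongr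
    _ = ∑ j ∈ range n, f n j := by rw [Finset.sum_div, Finset.sum_filter]
    _ ≤ ∑' j, f n j :=
        (summable_geometric_two.of_nonneg_of_le (hf_nonneg n) (hf_le n)).sum_le_tsum _
          fun j _ => hf_nonneg n j

/-- If `liminf q_r = 1` (where `q_r = k_r / k_{r-1}`), then there is a sequence
of random variables which is statistically convergent in probability but is not
`S_θ`-convergent of order `β` in probability for any `0 < β ≤ 1`. -/
theorem exists_statConvProb_not_lacStatConvProb_of_liminf_eq_one
    (θ : LacunarySeq)
    (hq : Filter.liminf (fun r : ℕ => (θ.k (r + 1) : ℝ) / (θ.k r : ℝ)) atTop = 1) :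
    ∃ (Ω : Type) (_ : MeasurableSpace Ω) (μ : Measure Ω),
      IsProbabilityMeasure μ ∧
      ∃ (X : ℕ → Ω → ℝ) (L : Ω → ℝ),
        (∀ n, Measurable (X n)) ∧ Measurable L ∧
        StatConvProb μ 1 X L ∧
        (∀ β : ℝ, 0 < β → β ≤ 1 → ¬ LacStatConvProb θ μ β X L) := by
  classical
  choose r hr_ge hr_gap using fun j : ℕ =>
    θ.exists_gap_le_of_liminf_eq_one hq (η := (1 / 2) ^ j) (by positivity) j
  let A : Set ℕ := {m | ∃ j, m ∈ Ioc (θ.k (r j)) (θ.k (r j + 1))}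
  refine ⟨Unit, inferInstance, Measure.dirac (), inferInstance,
    fun n _ => A.indicator 1 n, fun _ => 0, fun n => measurable_const, measurable_const, ?_, ?_⟩
  · intro ε hε δ hδ
    simp only [Real.rpow_one]
    refine tendsto_card_filter_div_of_short_blocks
      (fun j => (hr_ge j).trans (θ.k_mono.le_apply)) hr_gap _ fun m hm => ?_
    by_contra hmA
    have h0 : A.indicator (1 : ℕ → ℝ) m = 0 := Set.indicator_of_notMem (s := A) (fun h => hmA h) _
    simp only [probGe, h0, sub_zero, abs_zero, not_le.2 hε, Set.ofPred_false, measure_empty,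
      ENNReal.toReal_zero] at hm
    exact hm.not_gt hδ
  · intro β _ hβ hconv
    have hr_top : Tendsto r atTop atTop := tendsto_atTop_mono hr_ge tendsto_id
    refine absurd (ge_of_tendsto' ((hconv 1 one_pos 1 one_pos).comp hr_top) fun j => ?_)
      (not_le.2 (zero_lt_one' ℝ))
    have hall : ∀ m ∈ Ioc (θ.k (r j)) (θ.k (r j + 1)),
        1 ≤ probGe (Measure.dirac ()) (fun _ => A.indicator (1 : ℕ → ℝ) m) (fun _ => 0) 1 := by
      intro m hm
      have h1 : A.indicator (1 : ℕ → ℝ) m = 1 := Set.indicator_of_mem (s := A) ⟨j, hm⟩ _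
      simp [probGe, h1]
    have hpos : 0 < θ.k (r j + 1) - θ.k (r j) := Nat.sub_pos_of_lt (θ.k_mono (r j).lt_succ_self)
    have hone : (1 : ℝ) ≤ ((θ.k (r j + 1) - θ.k (r j) : ℕ) : ℝ) := by exact_mod_cast hpos
    simp only [Function.comp_apply]
    rw [Finset.filter_true_of_mem hall, Nat.card_Ioc, one_le_div (by positivity)]
    exact Real.rpow_le_self_of_one_le hone hβ
end
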